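/- arXiv:1810.09716 — 4 statements merged into one kernel-verified Lean document; each statement's English description precedes it below -/
import Mathlib

section
/- Let μ be a finite Borel measure on ℝ and let (μ_n)_{n∈ℕ} be a sequence of finite Borel measures on ℝ. Assume there is a compact set C ⊆ ℝ that contains the support of μ_n for every n, and that lim_{n→∞} ∫_ℝ f(t) dμ_n(t) = ∫_ℝ f(t) dμ(t) holds for every polynomial f ∈ ℝ[x]. Then μ_n converges weakly to μ, i.e. ∫_ℝ f dμ_n → ∫_ℝ f dμ for every bounded continuous function f : ℝ → ℝ. -/
open MeasureTheory Filter Topology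

/-- If the integrals of the powers of a nonnegative function stay bounded, then the function is at
most `1` almost everywhere. -/
lemma ae_le_one_of_integral_pow_le {α : Type*} [MeasurableSpace α] {μ : Measure α}
    [IsFiniteMeasure μ] {q : α → ℝ} (hq : ∀ x, 0 ≤ q x) {M : ℝ}
    (hint : ∀ k : ℕ, Integrable (fun x => q x ^ k) μ) (hM : ∀ k : ℕ, ∫ x, q x ^ k ∂μ ≤ M) :
    ∀ᵐ x ∂μ, q x ≤ 1 := by
  have level (b : ℝ) (hb : 1 < b) : μ {x | b ≤ q x} = 0 := by
    have bound (k : ℕ) : b ^ k * μ.real {x | b ≤ q x} ≤ M := by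
      have hb0 : 0 ≤ b := by linarith
      calc b ^ k * μ.real {x | b ≤ q x} ≤ b ^ k * μ.real {x | b ^ k ≤ q x ^ k} := by
            refine mul_le_mul_of_nonneg_left ?_ (pow_nonneg hb0 k)
            exact measureReal_mono (fun x (hx : b ≤ q x) => pow_le_pow_left₀ hb0 hx k)
              (measure_ne_top _ _)
        _ ≤ ∫ x, q x ^ k ∂μ :=
            mul_meas_ge_le_integral_of_nonneg (.of_forall fun x => pow_nonneg (hq x) k) (hint k) _
        _ ≤ M := hM k
    by_contra h
    have hpos : 0 < μ.real {x | b ≤ q x} :=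
      ENNReal.toReal_pos h (measure_ne_top _ _)
    obtain ⟨k, hk⟩ := pow_unbounded_of_one_lt (M / μ.real {x | b ≤ q x}) hb
    rw [div_lt_iff₀ hpos] at hk
    exact (bound k).not_gt hk
  have hall : ∀ᵐ x ∂μ, ∀ n : ℕ, q x < 1 + 1 / ((n : ℝ) + 1) := by
    refine ae_all_iff.2 fun n => ?_
    rw [ae_iff]
    simp only [not_lt]
    exact level _ (by simp; positivity)
  filter_upwards [hall] with x hx
  refine le_of_forall_pos_lt_add fun ε hε => ?_
  obtain ⟨n, hn⟩ := exists_nat_one_div_lt hε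
  linarith [hx n]

lemma integrable_eval_of_ae_mem_Icc {μ : Measure ℝ} [IsFiniteMeasure μ] {a b : ℝ}
    (h : ∀ᵐ x ∂μ, x ∈ Set.Icc a b) (p : Polynomial ℝ) : Integrable (fun x => p.eval x) μ := by
  obtain ⟨K, hK⟩ := isCompact_Icc.exists_bound_of_continuousOn
    (s := Set.Icc a b) p.continuous.continuousOn
  refine Integrable.of_bound p.continuous.aestronglyMeasurable K ?_
  filter_upwards [h] with x hx using hK x hx

lemma abs_integral_eval_sub_integral_le {μ : Measure ℝ} [IsFiniteMeasure μ] {a b ε : ℝ}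
    (h : ∀ᵐ x ∂μ, x ∈ Set.Icc a b) (p : Polynomial ℝ) (f : BoundedContinuousFunction ℝ ℝ)
    (hp : ∀ x ∈ Set.Icc a b, |p.eval x - f x| < ε) :
    |∫ x, p.eval x ∂μ - ∫ x, f x ∂μ| ≤ ε * μ.real Set.univ := by
  rw [← integral_sub (integrable_eval_of_ae_mem_Icc h p) (f.integrable μ)]
  refine norm_integral_le_of_norm_le_const (μ := μ) (f := fun x => p.eval x - f x) ?_
  filter_upwards [h] with x hx using (hp x hx).le

/-- If the integrals of all polynomials are limits of integrals against finite measures that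
integrate polynomials, then all polynomials are integrable for the limit measure: otherwise some
`p` and all its translates `p + c` would have integral `0`, which forces the limit to vanish. -/
lemma integrable_eval_of_tendsto_integral {μ : Measure ℝ} [IsFiniteMeasure μ]
    {μs : ℕ → Measure ℝ} [∀ n, IsFiniteMeasure (μs n)]
    (hint : ∀ n (p : Polynomial ℝ), Integrable (fun x => p.eval x) (μs n))
    (hpoly : ∀ f : Polynomial ℝ,
      Tendsto (fun n => ∫ t, f.eval t ∂(μs n)) atTop (𝓝 (∫ t, f.eval t ∂μ)))
    (p : Polynomial ℝ) : Integrable (fun x => p.eval x) μ := by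
  by_contra hp
  have hp1 : ¬ Integrable (fun x => (p + 1).eval x) μ := fun h => hp <| by
    simpa [Pi.sub_def] using h.sub (integrable_const (1 : ℝ))
  have h0 := hpoly p
  have h1 := hpoly (p + 1)
  rw [integral_undef hp] at h0
  rw [integral_undef hp1] at h1
  have hmass := hpoly 1
  have hdiff := h1.sub h0
  have heq : (fun n => ∫ t, (p + 1).eval t ∂(μs n) - ∫ t, p.eval t ∂(μs n)) =
      fun n => ∫ t, (1 : Polynomial ℝ).eval t ∂(μs n) := by
    funext n
    rw [← integral_sub (hint n _) (hint n _)]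
    simp
  rw [heq] at hdiff
  have hzero := tendsto_nhds_unique hmass hdiff
  have : μ = 0 := by simpa [measureReal_eq_zero_iff] using hzero
  exact hp (this ▸ integrable_zero_measure)

/-- If the integrals of every polynomial against finite measures living on a fixed interval
`[-R, R]` converge to the integrals against `μ`, then `μ` lives on `[-R, R]` too. -/
lemma ae_mem_Icc_of_tendsto_integral {μ : Measure ℝ} [IsFiniteMeasure μ]
    {μs : ℕ → Measure ℝ} [∀ n, IsFiniteMeasure (μs n)] {R : ℝ} (hR : 0 < R)
    (hsupp : ∀ n, ∀ᵐ x ∂(μs n), x ∈ Set.Icc (-R) R)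
    (hpoly : ∀ f : Polynomial ℝ,
      Tendsto (fun n => ∫ t, f.eval t ∂(μs n)) atTop (𝓝 (∫ t, f.eval t ∂μ))) :
    ∀ᵐ x ∂μ, x ∈ Set.Icc (-R) R := by
  have hint n := integrable_eval_of_ae_mem_Icc (hsupp n)
  have hintμ := integrable_eval_of_tendsto_integral hint hpoly
  let P (k : ℕ) : Polynomial ℝ := ((Polynomial.C R⁻¹ * Polynomial.X) ^ 2) ^ k
  have hP (k : ℕ) (x : ℝ) : (P k).eval x = ((R⁻¹ * x) ^ 2) ^ k := by simp [P]
  have key : ∀ᵐ x ∂μ, (R⁻¹ * x) ^ 2 ≤ 1 := by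
    refine ae_le_one_of_integral_pow_le (M := ∫ t, (1 : Polynomial ℝ).eval t ∂μ)
      (fun x => sq_nonneg _) (fun k => by simpa only [hP] using hintμ (P k)) fun k => ?_
    simp only [← hP]
    refine le_of_tendsto_of_tendsto' (hpoly (P k)) (hpoly 1) fun n => ?_
    refine integral_mono_ae (hint n _) (hint n _) ?_
    filter_upwards [hsupp n] with x hx
    rw [hP, Polynomial.eval_one]
    refine pow_le_one₀ (sq_nonneg _) ?_
    rw [sq_le_one_iff_abs_le_one, abs_mul, abs_inv, abs_of_pos hR, inv_mul_le_iff₀ hR, mul_one]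
    exact abs_le.2 hx
  filter_upwards [key] with x hx
  rw [sq_le_one_iff_abs_le_one, abs_mul, abs_inv, abs_of_pos hR, inv_mul_le_iff₀ hR, mul_one] at hx
  exact abs_le.1 hx

/-- If a sequence of finite Borel measures on ℝ is uniformly supported in a compact set
and the integrals of every polynomial converge to the corresponding integrals against a
finite Borel measure μ, then the sequence converges weakly to μ. -/
theorem stmt_0
    (μ : Measure ℝ) [IsFiniteMeasure μ]
    (μs : ℕ → Measure ℝ) [∀ n, IsFiniteMeasure (μs n)]
    (C : Set ℝ) (hC : IsCompact C)
    (hsupp : ∀ n, μs n Cᶜ = 0)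
    (hpoly : ∀ f : Polynomial ℝ,
      Tendsto (fun n => ∫ t, f.eval t ∂(μs n)) atTop (𝓝 (∫ t, f.eval t ∂μ))) :
    ∀ f : BoundedContinuousFunction ℝ ℝ,
      Tendsto (fun n => ∫ t, f t ∂(μs n)) atTop (𝓝 (∫ t, f t ∂μ)) := by
  intro f
  obtain ⟨R, hR, hCR⟩ := hC.isBounded.exists_pos_norm_le
  have hs (n : ℕ) : ∀ᵐ x ∂(μs n), x ∈ Set.Icc (-R) R := by
    have hmem : ∀ᵐ x ∂(μs n), x ∈ C := mem_ae_iff.2 (hsupp n)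
    filter_upwards [hmem] with x hx using abs_le.1 (hCR x hx)
  have hsμ := ae_mem_Icc_of_tendsto_integral hR hs hpoly
  have hmass : Tendsto (fun n => (μs n).real Set.univ) atTop (𝓝 (μ.real Set.univ)) := by
    simpa using hpoly 1
  have hm : 0 ≤ μ.real Set.univ := measureReal_nonneg
  rw [Metric.tendsto_nhds]
  intro δ hδ
  set ε := δ / (2 * (2 * μ.real Set.univ + 1)) with hε_def
  have hε : 0 < ε := by positivity
  have hεδ : ε * (2 * μ.real Set.univ + 1) = δ / 2 := by rw [hε_def]; field_simp
  obtain ⟨p, hp⟩ := exists_polynomial_near_of_continuousOn (-R) R f f.continuous.continuousOn ε hε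
  filter_upwards [hmass.eventually_lt_const (lt_add_one _),
    Metric.tendsto_nhds.1 (hpoly p) (δ / 2) (half_pos hδ)] with n hn hpn
  rw [Real.dist_eq] at hpn ⊢
  have h1 := abs_le.1 (abs_integral_eval_sub_integral_le (hs n) p f hp)
  have h2 := abs_le.1 (abs_integral_eval_sub_integral_le hsμ p f hp)
  have h3 := mul_lt_mul_of_pos_left hn hε
  rw [abs_lt] at hpn ⊢
  constructor <;> linarith [h1.1, h1.2, h2.1, h2.2, hpn.1, hpn.2]
end

section
/- Let (μ_n)_{n∈ℕ} be a sequence of finite Borel measures on ℝ converging weakly to a finite Borel measure μ. Suppose there is a constant c ≥ 0 such that μ_n((−ε,ε) \ {0}) ≤ c / log(1/ε) for every n ∈ ℕ and every ε ∈ (0,1). Then lim_{n→∞} μ_n({0}) = μ({0}). -/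
open MeasureTheory Filter Topology

/-- The tent function of height `1` supported on `[-ε, ε]`. -/
noncomputable def tent (ε : ℝ) (hε : 0 < ε) : BoundedContinuousFunction ℝ ℝ :=
  BoundedContinuousFunction.ofNormedAddCommGroup (fun t => max 0 (1 - |t| / ε)) (by fun_prop) 1
    (fun t => by
      have : 0 ≤ |t| / ε := by positivity
      rw [Real.norm_of_nonneg (le_max_left _ _)]
      exact max_le zero_le_one (by linarith))

lemma tent_apply (ε : ℝ) (hε : 0 < ε) (t : ℝ) : tent ε hε t = max 0 (1 - |t| / ε) := rfl

lemma measureReal_singleton_zero_le_integral_tent (ν : Measure ℝ) [IsFiniteMeasure ν]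
    (ε : ℝ) (hε : 0 < ε) : ν.real {0} ≤ ∫ t, tent ε hε t ∂ν := by
  rw [← integral_indicator_one (measurableSet_singleton 0)]
  refine integral_mono ((integrable_const (1 : ℝ)).indicator (measurableSet_singleton 0))
    ((tent ε hε).integrable ν) fun t => ?_
  by_cases ht : t = 0
  · simp [tent_apply, ht]
  · simp [tent_apply, ht]

lemma integral_tent_le_measureReal_Ioo (ν : Measure ℝ) [IsFiniteMeasure ν]
    (ε : ℝ) (hε : 0 < ε) : ∫ t, tent ε hε t ∂ν ≤ ν.real (Set.Ioo (-ε) ε) := by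
  rw [← integral_indicator_one measurableSet_Ioo]
  refine integral_mono ((tent ε hε).integrable ν)
    ((integrable_const (1 : ℝ)).indicator measurableSet_Ioo) fun t => ?_
  by_cases ht : t ∈ Set.Ioo (-ε) ε
  · have : 0 ≤ |t| / ε := by positivity
    simp only [tent_apply, Set.indicator_of_mem ht, Pi.one_apply]
    exact max_le zero_le_one (by linarith)
  · have : 1 ≤ |t| / ε := by
      rw [one_le_div hε]
      by_contra! h
      exact ht (abs_lt.mp h)
    simp only [tent_apply, Set.indicator_of_notMem ht]
    exact max_le le_rfl (by linarith)

lemma abs_integral_tent_sub_le (ν : Measure ℝ) [IsFiniteMeasure ν] (ε : ℝ) (hε : 0 < ε) :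
    |∫ t, tent ε hε t ∂ν - ν.real {0}| ≤ ν.real (Set.Ioo (-ε) ε \ {0}) := by
  have hsub : ({0} : Set ℝ) ⊆ Set.Ioo (-ε) ε := by simp [hε]
  rw [measureReal_sdiff hsub (measurableSet_singleton 0),
    abs_of_nonneg (sub_nonneg.mpr (measureReal_singleton_zero_le_integral_tent ν ε hε))]
  exact sub_le_sub_right (integral_tent_le_measureReal_Ioo ν ε hε) _

lemma tendsto_measureReal_punctured_Ioo (ν : Measure ℝ) [IsFiniteMeasure ν] :
    Tendsto (fun ε : ℝ => ν.real (Set.Ioo (-ε) ε \ {0})) (𝓝[>] 0) (𝓝 0) := by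
  have h := tendsto_measure_biInter_gt (μ := ν) (s := fun ε : ℝ => Set.Ioo (-ε) ε \ {0}) (a := 0)
    (fun ε _ => (measurableSet_Ioo.diff (measurableSet_singleton 0)).nullMeasurableSet)
    (fun i j _ hij => Set.sdiff_subset_sdiff_left (Set.Ioo_subset_Ioo (neg_le_neg hij) hij))
    ⟨1, one_pos, measure_ne_top _ _⟩
  have hempty : (⋂ ε > (0 : ℝ), Set.Ioo (-ε) ε \ {0}) = ∅ := by
    refine Set.eq_empty_of_forall_notMem fun t ht => ?_
    have ht' := Set.mem_iInter₂.mp ht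
    have h0 : 0 < |t| := abs_pos.mpr (ht' 1 one_pos).2
    exact lt_irrefl _ (abs_lt.mpr (ht' |t| h0).1)
  rw [hempty, measure_empty] at h
  exact (ENNReal.tendsto_toReal ENNReal.zero_ne_top).comp h

lemma tendsto_const_div_log_one_div (c : ℝ) :
    Tendsto (fun ε : ℝ => c / Real.log (1 / ε)) (𝓝[>] 0) (𝓝 0) := by
  simp only [one_div]
  exact (Real.tendsto_log_atTop.comp tendsto_inv_nhdsGT_zero).const_div_atTop c

/-- If finite Borel measures μₙ on ℝ converge weakly to a finite Borel measure μ and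
μₙ((−ε,ε) \ {0}) ≤ c / log(1/ε) uniformly in n for all 0 < ε < 1, then the atoms at 0
converge: μₙ({0}) → μ({0}). -/
theorem stmt_1
    (μ : Measure ℝ) [IsFiniteMeasure μ]
    (μs : ℕ → Measure ℝ) [∀ n, IsFiniteMeasure (μs n)]
    (hweak : ∀ f : BoundedContinuousFunction ℝ ℝ,
      Tendsto (fun n => ∫ t, f t ∂(μs n)) atTop (𝓝 (∫ t, f t ∂μ)))
    (c : ℝ) (hc : 0 ≤ c)
    (hbound : ∀ n : ℕ, ∀ ε : ℝ, 0 < ε → ε < 1 →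
      μs n (Set.Ioo (-ε) ε \ {0}) ≤ ENNReal.ofReal (c / Real.log (1 / ε))) :
    Tendsto (fun n => μs n {0}) atTop (𝓝 (μ {0})) := by
  suffices h : Tendsto (fun n => (μs n).real {0}) atTop (𝓝 (μ.real {0})) from
    (ENNReal.tendsto_toReal_iff (fun n => measure_ne_top _ _) (measure_ne_top _ _)).mp h
  rw [Metric.tendsto_atTop']
  intro δ hδ
  have hδ3 : 0 < δ / 3 := by positivity
  obtain ⟨ε, hμ, hlog, hε0, hε1⟩ :=
    (((tendsto_measureReal_punctured_Ioo μ).eventually_lt_const hδ3).and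
      (((tendsto_const_div_log_one_div c).eventually_lt_const hδ3).and
        (Ioo_mem_nhdsGT (zero_lt_one' ℝ)))).exists
  obtain ⟨N, hN⟩ := Metric.tendsto_atTop'.mp (hweak (tent ε hε0)) (δ / 3) hδ3
  refine ⟨N, fun n hn => ?_⟩
  have hlog0 : 0 ≤ c / Real.log (1 / ε) :=
    div_nonneg hc (Real.log_nonneg (one_le_one_div hε0 hε1.le))
  have hs : (μs n).real (Set.Ioo (-ε) ε \ {0}) ≤ c / Real.log (1 / ε) :=
    ENNReal.toReal_le_of_le_ofReal hlog0 (hbound n ε hε0 hε1)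
  have h1 := abs_le.mp (abs_integral_tent_sub_le (μs n) ε hε0)
  have h2 := abs_le.mp (abs_integral_tent_sub_le μ ε hε0)
  have h3 := abs_lt.mp (Real.dist_eq _ _ ▸ hN n hn)
  rw [Real.dist_eq, abs_lt]
  constructor <;> linarith [h1.1, h1.2, h2.1, h2.2, h3.1, h3.2]
end

section
/- Let A be a symmetric d×d matrix with integer entries whose eigenvalues λ_1, …, λ_d (listed with multiplicity) all satisfy |λ_i| ≤ R for some real number R ≥ 1, and let 0 < ε < 1. Then the number N of indices i with 0 < |λ_i| < ε satisfies N · log(1/ε) ≤ d · log R. -/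
open Polynomial

theorem trailingCoeff_map_of_injective {S T : Type*} [Semiring S] [Semiring T] (f : S →+* T)
    (hf : Function.Injective f) (p : S[X]) :
    (p.map f).trailingCoeff = f p.trailingCoeff := by
  rcases eq_or_ne p 0 with rfl | hp
  · simp
  have hn : (p.map f).natTrailingDegree = p.natTrailingDegree := by
    refine le_antisymm (natTrailingDegree_le_of_ne_zero ?_)
      (le_natTrailingDegree ((Polynomial.map_ne_zero_iff hf).2 hp) fun m hm ↦ ?_)
    · rw [coeff_map, map_ne_zero_iff f hf]
      exact trailingCoeff_nonzero_iff_nonzero.2 hp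
    · rw [coeff_map, coeff_eq_zero_of_lt_natTrailingDegree hm, map_zero]
  rw [trailingCoeff, trailingCoeff, hn, coeff_map]

theorem trailingCoeff_prod_of_noZeroDivisors {S ι : Type*} [CommSemiring S] [NoZeroDivisors S]
    (s : Finset ι) (f : ι → S[X]) :
    (∏ i ∈ s, f i).trailingCoeff = ∏ i ∈ s, (f i).trailingCoeff := by
  classical
  induction s using Finset.induction_on with
  | empty => simp [trailingCoeff]
  | insert a s ha ih => rw [Finset.prod_insert ha, Finset.prod_insert ha, trailingCoeff_mul, ih]

theorem log_abs_trailingCoeff_X_sub_C (a : ℝ) :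
    Real.log |(X - C a).trailingCoeff| = Real.log |a| := by
  rcases eq_or_ne a 0 with rfl | ha
  · have : (X : ℝ[X]).trailingCoeff = 1 := by
      rw [trailingCoeff, natTrailingDegree_X, coeff_X_one]
    simp [this]
  · rw [trailingCoeff_eq_coeff_zero (by simpa using ha)]
    simp

/-- The product of the absolute values of the nonzero roots of a monic integer polynomial is at
least `1`; the zero roots drop out of the sum because `Real.log 0 = 0`. -/
theorem sum_log_abs_nonneg_of_map_eq_prod {ι : Type*} (s : Finset ι) (a : ι → ℝ) (p : ℤ[X])
    (hp : p.map (Int.castRingHom ℝ) = ∏ i ∈ s, (X - C (a i))) :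
    0 ≤ ∑ i ∈ s, Real.log |a i| := by
  have hprod : p.map (Int.castRingHom ℝ) ≠ 0 := by
    rw [hp]
    exact (monic_prod_X_sub_C a s).ne_zero
  have hp0 : p ≠ 0 := by
    rintro rfl
    simp at hprod
  have htc : ((p.trailingCoeff : ℤ) : ℝ) = ∏ i ∈ s, (X - C (a i)).trailingCoeff := by
    rw [← trailingCoeff_prod_of_noZeroDivisors, ← hp,
      trailingCoeff_map_of_injective _ (RingHom.injective_int _), eq_intCast]
  have hlog : ∑ i ∈ s, Real.log |a i| = Real.log |(p.trailingCoeff : ℝ)| := by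
    rw [htc, Finset.abs_prod, Real.log_prod]
    · simp only [log_abs_trailingCoeff_X_sub_C]
    · intro i _
      exact abs_ne_zero.2 (trailingCoeff_nonzero_iff_nonzero.2 (X_sub_C_ne_zero _))
  rw [hlog]
  refine Real.log_nonneg ?_
  exact_mod_cast Int.one_le_abs (trailingCoeff_nonzero_iff_nonzero.2 hp0)

/-- For a symmetric integer d×d matrix whose eigenvalues λ₁,…,λ_d (with multiplicity)
all satisfy |λᵢ| ≤ R with R ≥ 1, and 0 < ε < 1, the number N of eigenvalues with
0 < |λᵢ| < ε satisfies N · log(1/ε) ≤ d · log R. -/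
theorem stmt_3 (d : ℕ) (A : Matrix (Fin d) (Fin d) ℤ) (hA : A.IsSymm)
    (lam : Fin d → ℝ)
    (hchar : (A.map (Int.cast : ℤ → ℝ)).charpoly = ∏ i, (X - C (lam i)))
    (R : ℝ) (hR : 1 ≤ R) (hbd : ∀ i, |lam i| ≤ R)
    (ε : ℝ) (hε0 : 0 < ε) (hε1 : ε < 1) :
    ((Finset.univ.filter (fun i => 0 < |lam i| ∧ |lam i| < ε)).card : ℝ)
        * Real.log (1 / ε) ≤ (d : ℝ) * Real.log R := by
  have hsum : 0 ≤ ∑ i, Real.log |lam i| := by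
    refine sum_log_abs_nonneg_of_map_eq_prod _ lam A.charpoly ?_
    rw [← hchar, ← Matrix.charpoly_map]
    rfl
  have hR0 : 0 ≤ Real.log R := Real.log_nonneg hR
  have hpt (i : Fin d) : Real.log |lam i| ≤
      Real.log R - if 0 < |lam i| ∧ |lam i| < ε then Real.log (1 / ε) else 0 := by
    split_ifs with h
    · have := Real.log_le_log h.1 h.2.le
      rw [one_div, Real.log_inv]
      linarith
    · rw [sub_zero]
      rcases (abs_nonneg (lam i)).eq_or_lt with h0 | h0
      · rwa [← h0, Real.log_zero]
      · exact Real.log_le_log h0 (hbd i)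
  have hle := hsum.trans (Finset.sum_le_sum fun i _ ↦ hpt i)
  rw [Finset.sum_sub_distrib, ← Finset.sum_filter] at hle
  simp only [Finset.sum_const, nsmul_eq_mul, Finset.card_univ, Fintype.card_fin] at hle
  linarith
end

section
/- Encode the simplices of the full simplicial complex Δ(ℕ₀) on vertex set ℕ by the bijection Υ : ℕ → {nonempty finite subsets of ℕ} sending n to the set of positions of the binary digits equal to 1 of n+1 (so Υ(0)={0}, Υ(1)={1}, Υ(2)={0,1}, Υ(3)={2}, …). A subcomplex of Δ(ℕ₀) is a set L of nonempty finite subsets of ℕ closed under passing to nonempty subsets; identify L with its code, the set {n ∈ ℕ : Υ(n) ∈ L} ⊆ ℕ. For distinct subsets A, B ⊆ ℕ, say A < B if the least element of the symmetric difference A Δ B lies in A. Claim: Let K be a connected, locally finite simplicial complex on a countable vertex set with a root vertex x. Then the collection of all subcomplexes L of Δ(ℕ₀) having 0 as a vertex and admitting a simplicial isomorphism onto K sending vertex 0 to x is nonempty, and it contains a unique element whose code is least with respect to the order <. -/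
/-- A simplicial complex on a vertex set `V`: a family of nonempty finite subsets of `V`
closed under passing to nonempty subsets. -/
def IsSimplicialComplex {V : Type*} (K : Set (Finset V)) : Prop :=
  (∀ s ∈ K, s.Nonempty) ∧ ∀ s ∈ K, ∀ t, t ⊆ s → t.Nonempty → t ∈ K

/-- The vertex set of a simplicial complex. -/
def vertices {V : Type*} (K : Set (Finset V)) : Set V :=
  {v | ∃ s ∈ K, v ∈ s}

/-- The bijection `Υ : ℕ → {nonempty finite subsets of ℕ}` sending `n` to the set of
positions of the binary digits equal to `1` of `n+1`. -/
def Upsilon (n : ℕ) : Finset ℕ :=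
  (Finset.range (n + 2)).filter (fun k => (n + 1).testBit k)

/-- The order on subsets of ℕ: `A < B` iff the least element of the symmetric
difference `A Δ B` lies in `A`. -/
def CodeLt (S T : Set ℕ) : Prop :=
  ∃ m, m ∈ S ∧ m ∉ T ∧ ∀ k < m, (k ∈ S ↔ k ∈ T)

/-- The code of a subcomplex `L` of `Δ(ℕ₀)`: the set of `n` with `Υ(n) ∈ L`. -/
def code (L : Set (Finset ℕ)) : Set ℕ := {n | Upsilon n ∈ L}

/-- The collection of subcomplexes of `Δ(ℕ₀)` having `0` as a vertex and admitting a
simplicial isomorphism onto `K` sending the vertex `0` to `x`. -/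
def RootedCopies {V : Type*} [DecidableEq V] (K : Set (Finset V)) (x : V) :
    Set (Set (Finset ℕ)) :=
  {L | IsSimplicialComplex L ∧ (0 : ℕ) ∈ vertices L ∧
    ∃ e : ℕ → V, e 0 = x ∧ Set.BijOn e (vertices L) (vertices K) ∧
      ∀ σ : Finset ℕ, ↑σ ⊆ vertices L → (σ ∈ L ↔ σ.image e ∈ K)}

open Filter

theorem Upsilon_eq_toFinset_bitIndices (n : ℕ) :
    Upsilon n = (n + 1).bitIndices.toFinset := by
  ext i
  simp only [Upsilon, Finset.mem_filter, Finset.mem_range, List.mem_toFinset, Nat.mem_bitIndices,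
    and_iff_right_iff_imp]
  intro h
  have h₁ := Nat.ge_two_pow_of_testBit h
  have h₂ := i.lt_two_pow_self
  omega

theorem sum_two_pow_Upsilon (n : ℕ) : ∑ i ∈ Upsilon n, 2 ^ i = n + 1 := by
  rw [Upsilon_eq_toFinset_bitIndices, Finset.sum_toFinset_bitIndices_two_pow]

theorem Upsilon_injective : Function.Injective Upsilon := by
  intro m n h
  have hm := sum_two_pow_Upsilon m
  rw [h, sum_two_pow_Upsilon] at hm
  omega

theorem Upsilon_nonempty (n : ℕ) : (Upsilon n).Nonempty := by
  rw [Finset.nonempty_iff_ne_empty]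
  intro h
  have := sum_two_pow_Upsilon n
  simp [h] at this

theorem exists_Upsilon_eq {σ : Finset ℕ} (hσ : σ.Nonempty) : ∃ n, Upsilon n = σ := by
  obtain ⟨i, hi⟩ := hσ
  have h : 0 < ∑ i ∈ σ, 2 ^ i := Finset.sum_pos (fun _ _ => by positivity) ⟨i, hi⟩
  refine ⟨∑ i ∈ σ, 2 ^ i - 1, ?_⟩
  rw [Upsilon_eq_toFinset_bitIndices, Nat.sub_add_cancel h,
    Finset.toFinset_bitIndices_sum_two_pow]

theorem le_of_mem_Upsilon_of_lt {m n j k : ℕ} (hjk : j < k) (hn : Upsilon n = {j, k})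
    (hmn : m < n) {i : ℕ} (hi : i ∈ Upsilon m) : i ≤ k := by
  have hs := sum_two_pow_Upsilon n
  rw [hn, Finset.sum_pair hjk.ne] at hs
  have h₁ : 2 ^ i ≤ m + 1 := by
    rw [← sum_two_pow_Upsilon m]
    exact Finset.single_le_sum (f := fun i => 2 ^ i) (fun _ _ => Nat.zero_le _) hi
  by_contra! hki
  have h₂ : 2 ^ (k + 1) ≤ 2 ^ i := Nat.pow_le_pow_right (by norm_num) hki
  have h₃ : 2 ^ j < 2 ^ k := Nat.pow_lt_pow_right (by norm_num) hjk
  rw [pow_succ] at h₂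
  omega

theorem le_of_mem_Upsilon_of_lt_of_ne {m n j k : ℕ} (hjk : j < k) (hn : Upsilon n = {j, k})
    (hmn : m < n) (hk : k ∈ Upsilon m) {i : ℕ} (hi : i ∈ Upsilon m) (hik : i ≠ k) : i ≤ j := by
  have hs := sum_two_pow_Upsilon n
  rw [hn, Finset.sum_pair hjk.ne] at hs
  have h₁ : 2 ^ i + 2 ^ k ≤ m + 1 := by
    rw [← sum_two_pow_Upsilon m, ← Finset.sum_pair (f := fun i => 2 ^ i) hik]
    refine Finset.sum_le_sum_of_subset ?_
    simp [Finset.insert_subset_iff, hi, hk]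
  by_contra! hji
  have h₂ : 2 ^ j < 2 ^ i := Nat.pow_lt_pow_right (by norm_num) hji
  omega

theorem CodeLt.asymm {S T : Set ℕ} (h : CodeLt S T) (h' : CodeLt T S) : False := by
  obtain ⟨m, hm, hm', hlt⟩ := h
  obtain ⟨n, hn, hn', hlt'⟩ := h'
  rcases lt_trichotomy m n with h | rfl | h
  · exact hm' ((hlt' m h).2 hm)
  · exact hm' hn
  · exact hn' ((hlt n h).2 hn)

/-- Two distinct sets of natural numbers have a least point of disagreement. -/
theorem exists_least_disagreement {S T : Set ℕ} (h : S ≠ T) :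
    ∃ m, ¬(m ∈ S ↔ m ∈ T) ∧ ∀ k < m, (k ∈ S ↔ k ∈ T) := by
  classical
  have h' : ∃ m, ¬(m ∈ S ↔ m ∈ T) := by
    by_contra! hST
    exact h (Set.ext hST)
  exact ⟨Nat.find h', Nat.find_spec h', fun k hk => not_not.1 (Nat.find_min h' hk)⟩

/-- Every nonempty family of sets of natural numbers has a lexicographic infimum which is a
limit of members of the family. -/
theorem exists_lexicographic_limit {C : Set (Set ℕ)} (hC : C.Nonempty) :
    ∃ S : Set ℕ, (∀ n, ∃ A ∈ C, ∀ k < n, (k ∈ A ↔ k ∈ S)) ∧ ∀ A ∈ C, A ≠ S → CodeLt S A := by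
  obtain ⟨A₀, hA₀⟩ := hC
  have step : ∀ (n : ℕ) (A : C), ∃ B : C, (∀ k < n, (k ∈ B.1 ↔ k ∈ A.1)) ∧
      ∀ D ∈ C, (∀ k < n, (k ∈ D ↔ k ∈ A.1)) → n ∈ D → n ∈ B.1 := by
    intro n A
    by_cases h : ∃ D ∈ C, (∀ k < n, (k ∈ D ↔ k ∈ A.1)) ∧ n ∈ D
    · obtain ⟨D, hD, hDA, hn⟩ := h
      exact ⟨⟨D, hD⟩, hDA, fun _ _ _ _ => hn⟩
    · exact ⟨A, fun _ _ => Iff.rfl, fun D hD hDA hn => (h ⟨D, hD, hDA, hn⟩).elim⟩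
  choose next hnext hbest using step
  let f : ℕ → C := Nat.rec ⟨A₀, hA₀⟩ next
  have hf : ∀ n, f (n + 1) = next n (f n) := fun _ => rfl
  have hstable : ∀ n m, n ≤ m → ∀ k < n, (k ∈ (f m).1 ↔ k ∈ (f n).1) := by
    intro n m hnm
    induction m, hnm using Nat.le_induction with
    | base => exact fun _ _ => Iff.rfl
    | succ m hnm ih =>
      intro k hk
      rw [hf, hnext m (f m) k (hk.trans_le hnm), ih k hk]
  have hlim : ∀ n, ∀ k < n, (k ∈ (f n).1 ↔ k ∈ {k | k ∈ (f (k + 1)).1}) :=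
    fun n k hk => hstable (k + 1) n hk k k.lt_succ_self
  refine ⟨{k | k ∈ (f (k + 1)).1}, fun n => ⟨(f n).1, (f n).2, hlim n⟩, fun A hA hne => ?_⟩
  obtain ⟨m, hm, hlt⟩ := exists_least_disagreement hne
  have hmem : m ∈ A → m ∈ (f (m + 1)).1 := by
    rw [hf]
    exact hbest m (f m) A hA fun k hk => (hlt k hk).trans (hlim m k hk).symm
  have hmA : m ∉ A := fun h => hm ⟨fun _ => hmem h, fun _ => h⟩
  refine ⟨m, ?_, hmA, fun k hk => (hlt k hk).symm⟩
  by_contra h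
  exact hm ⟨fun h' => (hmA h').elim, fun h' => (h h').elim⟩

theorem code_injOn : Set.InjOn code {L | IsSimplicialComplex L} := by
  intro L hL L' hL' h
  ext σ
  constructor <;> intro hσ
  · obtain ⟨n, rfl⟩ := exists_Upsilon_eq (hL.1 σ hσ)
    exact (Set.ext_iff.1 h n).1 hσ
  · obtain ⟨n, rfl⟩ := exists_Upsilon_eq (hL'.1 σ hσ)
    exact (Set.ext_iff.1 h n).2 hσ

theorem IsSimplicialComplex.singleton_mem_iff {V : Type*} {K : Set (Finset V)}
    (hK : IsSimplicialComplex K) {v : V} : {v} ∈ K ↔ v ∈ vertices K := by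
  refine ⟨fun h => ⟨_, h, Finset.mem_singleton_self v⟩, ?_⟩
  rintro ⟨s, hs, hv⟩
  exact hK.2 s hs _ (Finset.singleton_subset_iff.2 hv) (Finset.singleton_nonempty v)

theorem IsSimplicialComplex.image {V W : Type*} [DecidableEq W] {K : Set (Finset V)}
    (hK : IsSimplicialComplex K) (f : V → W) :
    IsSimplicialComplex ((fun s => s.image f) '' K) := by
  constructor
  · rintro _ ⟨s, hs, rfl⟩
    exact (hK.1 s hs).image f
  · rintro _ ⟨s, hs, rfl⟩ t ht hne
    obtain ⟨u, hu, rfl⟩ := Finset.subset_image_iff.1 ht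
    exact ⟨u, hK.2 s hs u (by simpa using hu) (Finset.image_nonempty.1 hne), rfl⟩

theorem vertices_image {V W : Type*} [DecidableEq W] (K : Set (Finset V)) (f : V → W) :
    vertices ((fun s => s.image f) '' K) = f '' vertices K := by
  ext w
  simp only [vertices, Set.mem_ofPred_eq, Set.mem_image, exists_exists_and_eq_and, Finset.mem_image]
  grind

section Rooted

variable {V : Type*} [DecidableEq V] {K : Set (Finset V)} {x : V}

theorem RootedCopies.nonempty [Countable V] (hK : IsSimplicialComplex K) (hx : x ∈ vertices K) :
    (RootedCopies K x).Nonempty := by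
  obtain ⟨g, hg⟩ := exists_injective_nat V
  let f : V → ℕ := fun v => Equiv.swap (g x) 0 (g v)
  have hf : f.Injective := (Equiv.injective _).comp hg
  have hfx : f x = 0 := Equiv.swap_apply_left _ _
  have : Nonempty V := ⟨x⟩
  have hinv : Function.LeftInverse (Function.invFun f) f := Function.leftInverse_invFun hf
  refine ⟨(fun s => s.image f) '' K, hK.image f, ?_, Function.invFun f, ?_, ?_, ?_⟩
  · rw [vertices_image]
    exact ⟨x, hx, hfx⟩
  · rw [← hfx, hinv]
  · rw [vertices_image]
    refine ⟨?_, ?_, ?_⟩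
    · rintro _ ⟨v, hv, rfl⟩
      rwa [hinv]
    · rintro _ ⟨v, hv, rfl⟩ _ ⟨w, hw, rfl⟩ h
      rw [hinv, hinv] at h
      rw [h]
    · exact fun v hv => ⟨f v, ⟨v, hv, rfl⟩, hinv v⟩
  · intro σ hσ
    rw [vertices_image] at hσ
    have key : ∀ s : Finset V, (s.image f).image (Function.invFun f) = s := fun s => by
      rw [Finset.image_image, hinv.comp_eq_id, Finset.image_id]
    obtain ⟨s, -, rfl⟩ := Finset.subset_set_image_iff.1 hσ
    rw [key]
    exact ⟨fun ⟨t, ht, h⟩ => Finset.image_injective hf h ▸ ht, fun h => ⟨s, h, rfl⟩⟩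

/-- Relabelling a rooted copy by a permutation fixing the root gives a rooted copy. -/
theorem RootedCopies.relabel {L : Set (Finset ℕ)} (hL : L ∈ RootedCopies K x)
    (π : Equiv.Perm ℕ) (hπ : π 0 = 0) : {σ | σ.image π ∈ L} ∈ RootedCopies K x := by
  obtain ⟨hc, h0, e, he0, hbij, he⟩ := hL
  have hc' : IsSimplicialComplex {σ : Finset ℕ | σ.image π ∈ L} :=
    ⟨fun s hs => Finset.image_nonempty.1 (hc.1 _ hs), fun s hs t ht hne =>
      hc.2 _ hs _ (Finset.image_subset_image ht) (hne.image π)⟩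
  have hv : vertices {σ : Finset ℕ | σ.image π ∈ L} = π ⁻¹' vertices L := by
    ext i
    rw [← hc'.singleton_mem_iff, Set.mem_preimage, ← hc.singleton_mem_iff]
    simp
  refine ⟨hc', ?_, e ∘ π, ?_, ?_, ?_⟩
  · rw [hv, Set.mem_preimage, hπ]
    exact h0
  · simp [hπ, he0]
  · rw [hv]
    refine hbij.comp ⟨fun _ h => h, π.injective.injOn, fun i hi => ⟨π.symm i, ?_, by simp⟩⟩
    simpa using hi
  · intro σ hσ
    rw [hv] at hσ
    rw [← Finset.image_image, Set.mem_ofPred_eq]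
    refine he _ ?_
    rw [Finset.coe_image]
    exact Set.image_subset_iff.2 hσ

/-- Let `M` be a family such that the first difference of a rooted copy from `M` is always a
simplex of `M`, and let `L` be a rooted copy agreeing with `M` on `{0, …, k}`. If `j < k` is
joined in `L` to a vertex beyond `k`, then in `M` the vertex `k` is joined to some `i ≤ j`. -/
theorem exists_edge_of_lexicographic_min {M L : Set (Finset ℕ)}
    (hmin : ∀ L' ∈ RootedCopies K x, ∀ n, Upsilon n ∈ L' → Upsilon n ∉ M →
      ∃ m < n, Upsilon m ∈ M ∧ Upsilon m ∉ L')
    (hL : L ∈ RootedCopies K x) {j k l : ℕ} (hjk : j < k) (hkl : k < l)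
    (hjl : {j, l} ∈ L) (hagree : ∀ σ ⊆ Finset.range (k + 1), (σ ∈ L ↔ σ ∈ M)) :
    ∃ i ≤ j, {i, k} ∈ M := by
  by_contra! hno
  obtain ⟨n, hn⟩ := exists_Upsilon_eq (σ := {j, k}) (by simp)
  have hmem : Upsilon n ∈ {σ : Finset ℕ | σ.image (Equiv.swap k l) ∈ L} := by
    rw [Set.mem_ofPred_eq, hn, Finset.image_insert, Finset.image_singleton, Equiv.swap_apply_left,
      Equiv.swap_apply_of_ne_of_ne hjk.ne (hjk.trans hkl).ne]
    exact hjl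
  obtain ⟨m, hmn, hmM, hmL⟩ := hmin _
    (RootedCopies.relabel hL (Equiv.swap k l)
      (Equiv.swap_apply_of_ne_of_ne (by omega) (by omega))) n hmem (hn ▸ hno j le_rfl)
  have hle : ∀ i ∈ Upsilon m, i ≤ k := fun i hi => le_of_mem_Upsilon_of_lt hjk hn hmn hi
  have hsub : Upsilon m ⊆ Finset.range (k + 1) := fun i hi =>
    Finset.mem_range.2 (Nat.lt_succ_of_le (hle i hi))
  have hm : Upsilon m ∈ L := (hagree _ hsub).2 hmM
  apply hmL
  rw [Set.mem_ofPred_eq]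
  by_cases hk : k ∈ Upsilon m
  · have hsing : Upsilon m = {k} := by
      refine Finset.eq_singleton_iff_unique_mem.2 ⟨hk, fun i hi => ?_⟩
      by_contra hik
      refine hno i (le_of_mem_Upsilon_of_lt_of_ne hjk hn hmn hk hi hik) ?_
      have hik' : ({i, k} : Finset ℕ) ⊆ Upsilon m := by
        simp [Finset.insert_subset_iff, hi, hk]
      exact (hagree _ (hik'.trans hsub)).1 (hL.1.2 _ hm _ hik' (by simp))
    rw [hsing, Finset.image_singleton, Equiv.swap_apply_left]
    exact hL.1.2 _ hjl _ (by simp) (by simp)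
  · have hfix : (Upsilon m).image (Equiv.swap k l) = Upsilon m := by
      refine (Finset.image_congr fun i hi => ?_).trans Finset.image_id
      have h₁ := hle i hi
      have h₂ : i ≠ k := fun h => hk (h ▸ hi)
      exact Equiv.swap_apply_of_ne_of_ne h₂ (by omega)
    rwa [hfix]

/-- In a connected complex, a nonempty vertex set is left by some edge. -/
theorem exists_edge_leaving
    (hconn : ∀ u ∈ vertices K, ∀ w ∈ vertices K,
      Relation.ReflTransGen (fun a b => a ≠ b ∧ ({a, b} : Finset V) ∈ K) u w)
    {P : Set V} {u w : V} (hu : u ∈ vertices K) (hw : w ∈ vertices K) (huP : u ∈ P)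
    (hwP : w ∉ P) : ∃ a ∈ P, ∃ b ∉ P, ({a, b} : Finset V) ∈ K := by
  by_contra! h
  have key : ∀ b, Relation.ReflTransGen (fun a b => a ≠ b ∧ ({a, b} : Finset V) ∈ K) u b →
      b ∈ P := by
    intro b hb
    induction hb with
    | refl => exact huP
    | tail _ hbc ih =>
      by_contra hc
      exact h _ ih _ hc hbc.2
  exact hwP (key w (hconn u hu w hw))

theorem finite_neighbors (hlf : ∀ v : V, {σ ∈ K | v ∈ σ}.Finite) (v : V) :
    {w : V | ({v, w} : Finset V) ∈ K}.Finite := by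
  refine ((hlf v).biUnion fun σ _ => σ.finite_toSet).subset fun w hw => ?_
  simp only [Set.mem_iUnion]
  exact ⟨{v, w}, ⟨hw, by simp⟩, by simp⟩

/-- A lexicographically extremal limit of rooted copies is a rooted copy. -/
theorem RootedCopies.limit_mem
    (hconn : ∀ u ∈ vertices K, ∀ w ∈ vertices K,
      Relation.ReflTransGen (fun a b => a ≠ b ∧ ({a, b} : Finset V) ∈ K) u w)
    (hlf : ∀ v : V, {σ ∈ K | v ∈ σ}.Finite) (hx : x ∈ vertices K)
    {M : Set (Finset ℕ)} {L : ℕ → Set (Finset ℕ)} (hL : ∀ n, L n ∈ RootedCopies K x)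
    (hlim : ∀ σ, ∀ᶠ n in atTop, (σ ∈ L n ↔ σ ∈ M))
    (hmin : ∀ L' ∈ RootedCopies K x, ∀ n, Upsilon n ∈ L' → Upsilon n ∉ M →
      ∃ m < n, Upsilon m ∈ M ∧ Upsilon m ∉ L') :
    M ∈ RootedCopies K x := by
  have hL' := hL
  choose hc h0 e he0 hbij he using hL'
  have hagree : ∀ k, ∀ᶠ n in atTop, ∀ σ ⊆ Finset.range k, (σ ∈ L n ↔ σ ∈ M) := by
    intro k
    have := (Finset.range k).powerset.eventually_all (l := atTop)
      (p := fun σ n => (σ ∈ L n ↔ σ ∈ M)) |>.2 fun σ _ => hlim σ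
    simpa using this
  have hcM : IsSimplicialComplex M := by
    constructor
    · intro σ hσ
      obtain ⟨n, hn⟩ := (hlim σ).exists
      exact (hc n).1 σ (hn.2 hσ)
    · intro σ hσ τ hτ hne
      obtain ⟨n, hn, hn'⟩ := ((hlim σ).and (hlim τ)).exists
      exact hn'.1 ((hc n).2 σ (hn.2 hσ) τ hτ hne)
  have hvert : ∀ i, ∀ᶠ n in atTop, (i ∈ vertices (L n) ↔ i ∈ vertices M) := by
    intro i
    filter_upwards [hlim {i}] with n hn
    rwa [← (hc n).singleton_mem_iff, ← hcM.singleton_mem_iff]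
  have hedge : ∀ n i l, i ∈ vertices (L n) → l ∈ vertices (L n) →
      ({i, l} ∈ L n ↔ {e n i, e n l} ∈ K) := by
    intro n i l hi hl
    rw [he n {i, l} (by simp [Set.insert_subset_iff, hi, hl])]
    simp
  have hparent : ∀ k ∈ vertices M, k ≠ 0 → ∃ i < k, {i, k} ∈ M := by
    intro k hk hk0
    obtain ⟨n, hn, hkn⟩ := ((hagree (k + 1)).and (hvert k)).exists
    obtain ⟨_, ⟨i, ⟨hi, hik⟩, rfl⟩, b, hb, hib⟩ := exists_edge_leaving hconn
      (P := e n '' (vertices (L n) ∩ Set.Iio k)) (u := x) (w := e n k) hx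
      ((hbij n).mapsTo (hkn.2 hk)) ⟨0, ⟨h0 n, Nat.pos_of_ne_zero hk0⟩, he0 n⟩
      (by
        rintro ⟨i, ⟨hi, hik⟩, hie⟩
        exact (hik : i < k).ne ((hbij n).injOn hi (hkn.2 hk) hie))
    obtain ⟨l, hl, rfl⟩ := (hbij n).surjOn (show b ∈ vertices K from ⟨_, hib, by simp⟩)
    have hil : {i, l} ∈ L n := (hedge n i l hi hl).2 hib
    have hkl : k ≤ l := by
      by_contra! hlk
      exact hb ⟨l, ⟨hl, hlk⟩, rfl⟩
    have hik : i < k := hik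
    rcases hkl.eq_or_lt with rfl | hkl
    · refine ⟨i, hik, (hn _ ?_).1 hil⟩
      simp [Finset.insert_subset_iff]
      omega
    · obtain ⟨i', hi', h⟩ := exists_edge_of_lexicographic_min hmin (hL n) hik hkl hil hn
      exact ⟨i', hi'.trans_lt hik, h⟩
  let U : Ultrafilter ℕ := hyperfilter ℕ
  have hU : ∀ {p : ℕ → Prop}, (∀ᶠ n in atTop, p n) → ∀ᶠ n in (U : Filter ℕ), p n :=
    fun h => Nat.hyperfilter_le_atTop h
  have hexists : ∀ k, ∃ v, k ∈ vertices M → ∀ᶠ n in (U : Filter ℕ), e n k = v := by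
    intro k
    induction k using Nat.strong_induction_on with
    | _ k ih =>
      by_cases hk : k ∈ vertices M
      swap
      · exact ⟨x, fun h => (hk h).elim⟩
      by_cases hk0 : k = 0
      · exact ⟨x, fun _ => Eventually.of_forall fun n => hk0 ▸ he0 n⟩
      obtain ⟨i, hik, hikM⟩ := hparent k hk hk0
      obtain ⟨v, hv⟩ := ih i hik
      have hi : i ∈ vertices M := ⟨_, hikM, by simp⟩
      have hev : ∀ᶠ n in (U : Filter ℕ), ∃ w ∈ {w : V | ({v, w} : Finset V) ∈ K}, e n k = w := by
        filter_upwards [hv hi, hU (hlim {i, k}), hU (hvert i), hU (hvert k)] with n h₁ h₂ h₃ h₄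
        refine ⟨_, ?_, rfl⟩
        rw [← h₁, ← hedge n i k (h₃.2 hi) (h₄.2 hk)]
        exact h₂.2 hikM
      obtain ⟨w, -, hw⟩ := (Ultrafilter.eventually_exists_mem_iff (finite_neighbors hlf v)).1 hev
      exact ⟨w, fun _ => hw⟩
  choose f hf using hexists
  have h0M : 0 ∈ vertices M := by
    obtain ⟨n, hn⟩ := (hvert 0).exists
    exact hn.1 (h0 n)
  have hf0 : f 0 = x := by
    obtain ⟨n, hn⟩ := (hf 0 h0M).exists
    rw [← hn, he0]
  have hmaps : Set.MapsTo f (vertices M) (vertices K) := by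
    intro i hi
    obtain ⟨n, hn, hn'⟩ := ((hf i hi).and (hU (hvert i))).exists
    exact hn ▸ (hbij n).mapsTo (hn'.2 hi)
  have hinj : Set.InjOn f (vertices M) := by
    intro i hi l hl hil
    obtain ⟨n, ⟨h₁, h₂⟩, h₃, h₄⟩ := (((hf i hi).and (hf l hl)).and
      ((hU (hvert i)).and (hU (hvert l)))).exists
    exact (hbij n).injOn (h₃.2 hi) (h₄.2 hl) (by rw [h₁, h₂, hil])
  have hiso : ∀ σ : Finset ℕ, ↑σ ⊆ vertices M → (σ ∈ M ↔ σ.image f ∈ K) := by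
    intro σ hσ
    have h₁ : ∀ᶠ n in (U : Filter ℕ), ∀ i ∈ σ, e n i = f i ∧ i ∈ vertices (L n) :=
      σ.eventually_all.2 fun i hi => by
        filter_upwards [hf i (hσ hi), hU (hvert i)] with n h h' using ⟨h, h'.2 (hσ hi)⟩
    obtain ⟨n, hn, hn'⟩ := (h₁.and (hU (hlim σ))).exists
    rw [← hn', he n σ fun i hi => (hn i hi).2, Finset.image_congr fun i hi => (hn i hi).1]
  refine ⟨hcM, h0M, f, hf0, ⟨hmaps, hinj, fun v hv => ?_⟩, hiso⟩
  by_contra hvf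
  obtain ⟨_, ⟨j, hj, rfl⟩, w, hw, hjw⟩ := exists_edge_leaving hconn (P := f '' vertices M)
    hx hv ⟨0, h0M, hf0⟩ hvf
  have hwK : w ∈ vertices K := ⟨_, hjw, by simp⟩
  have hfin : {k | ∃ i ≤ j, {i, k} ∈ M}.Finite := by
    have : {k | ∃ i ≤ j, {i, k} ∈ M} = ⋃ i ∈ Set.Iic j, {k | {i, k} ∈ M} := by
      ext k
      simp
    rw [this]
    refine (Set.finite_Iic j).biUnion fun i _ => ?_
    refine Set.Finite.of_finite_image (f := f)
      ((finite_neighbors hlf (f i)).subset ?_) (hinj.mono fun k hk =>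
        show k ∈ vertices M from ⟨{i, k}, hk, by simp⟩)
    rintro _ ⟨k, hk, rfl⟩
    have hk' := (hiso {i, k} fun a ha => ⟨_, hk, ha⟩).1 hk
    simpa using hk'
  obtain ⟨k, hk, hjk⟩ := (hfin.union (Set.finite_Iic j)).infinite_compl.nonempty.imp
    fun k hk => not_or.1 hk
  have hjk : j < k := not_le.1 hjk
  have hall : ∀ᶠ n in (U : Filter ℕ), ∀ i ∈ Finset.range (k + 1),
      (i ∈ vertices (L n) ↔ i ∈ vertices M) ∧ (i ∈ vertices M → e n i = f i) :=
    (Finset.eventually_all _).2 fun i _ => by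
      by_cases hi : i ∈ vertices M
      · filter_upwards [hf i hi, hU (hvert i)] with n h h' using ⟨h', fun _ => h⟩
      · filter_upwards [hU (hvert i)] with n h' using ⟨h', fun h => (hi h).elim⟩
  obtain ⟨n, hn, hagr⟩ := (hall.and (hU (hagree (k + 1)))).exists
  obtain ⟨l, hl, rfl⟩ := (hbij n).surjOn hwK
  have hkl : k < l := by
    by_contra! hlk
    obtain ⟨h₁, h₂⟩ := hn l (Finset.mem_range.2 (by omega))
    exact hw ⟨l, h₁.1 hl, (h₂ (h₁.1 hl)).symm⟩
  obtain ⟨h₁, h₂⟩ := hn j (Finset.mem_range.2 (by omega))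
  rw [← h₂ hj, ← hedge n j l (h₁.2 hj) hl] at hjw
  exact hk (exists_edge_of_lexicographic_min hmin (hL n) hjk hkl hjw hagr)

end Rooted

/-- For every connected, locally finite simplicial complex `K` on a countable vertex
set with root vertex `x`, the collection of subcomplexes of `Δ(ℕ₀)` rooted-isomorphic
to `(K,x)` (with root `0`) is nonempty and contains a unique element whose code is
least with respect to the order `CodeLt`. -/
theorem stmt_11 {V : Type*} [Countable V] [DecidableEq V]
    (K : Set (Finset V)) (hK : IsSimplicialComplex K)
    (hconn : ∀ u ∈ vertices K, ∀ w ∈ vertices K,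
      Relation.ReflTransGen (fun a b => a ≠ b ∧ ({a, b} : Finset V) ∈ K) u w)
    (hlf : ∀ v : V, {σ ∈ K | v ∈ σ}.Finite)
    (x : V) (hx : x ∈ vertices K) :
    (RootedCopies K x).Nonempty ∧
      ∃! L : Set (Finset ℕ), L ∈ RootedCopies K x ∧
        ∀ L' ∈ RootedCopies K x, L' ≠ L → CodeLt (code L) (code L') := by
  have hne := RootedCopies.nonempty hK hx
  refine ⟨hne, ?_⟩
  obtain ⟨S, hS, hlt⟩ := exists_lexicographic_limit (hne.image code)
  let M : Set (Finset ℕ) := Upsilon '' S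
  have hMS : ∀ n, Upsilon n ∈ M ↔ n ∈ S := fun n => Upsilon_injective.mem_set_image
  have hcode : code M = S := Set.ext hMS
  have hS' : ∀ n, ∃ L ∈ RootedCopies K x, ∀ k < n, (Upsilon k ∈ L ↔ k ∈ S) := by
    intro n
    obtain ⟨_, ⟨L, hL, rfl⟩, h⟩ := hS n
    exact ⟨L, hL, h⟩
  choose L hL hagree using hS'
  have hM : M ∈ RootedCopies K x := by
    refine RootedCopies.limit_mem hconn hlf hx hL (fun σ => ?_) fun L' hL' n hn hnM => ?_
    · rcases σ.eq_empty_or_nonempty with rfl | hσ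
      · refine Eventually.of_forall fun n => iff_of_false (fun h => ?_) ?_
        · exact Finset.not_nonempty_empty ((hL n).1.1 _ h)
        · rintro ⟨m, -, hm⟩
          exact (Upsilon_nonempty m).ne_empty hm
      · obtain ⟨m, rfl⟩ := exists_Upsilon_eq hσ
        filter_upwards [eventually_gt_atTop m] with n hn
        rw [hMS, hagree n m hn]
    · have hnS : n ∉ S := fun h => hnM ((hMS n).2 h)
      obtain ⟨m, hmS, hmL, hm⟩ := hlt (code L') ⟨L', hL', rfl⟩ fun h => hnS (h ▸ hn)
      refine ⟨m, ?_, (hMS m).2 hmS, hmL⟩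
      rcases lt_trichotomy m n with h | rfl | h
      · exact h
      · exact (hmL hn).elim
      · exact (hnS ((hm n h).2 hn)).elim
  have hleast : ∀ L' ∈ RootedCopies K x, L' ≠ M → CodeLt (code M) (code L') := by
    intro L' hL' hne'
    rw [hcode]
    exact hlt _ ⟨L', hL', rfl⟩ fun h => hne' (code_injOn hL'.1 hM.1 (h.trans hcode.symm))
  refine ⟨M, ⟨hM, hleast⟩, fun L' ⟨hL', hleast'⟩ => ?_⟩
  by_contra hne'
  exact (hleast L' hL' hne').asymm (hleast' M hM (Ne.symm hne'))
end
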